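/- arXiv:2309.01011 — 2 statements merged into one kernel-verified Lean document; each statement's English description precedes it below -/
import Mathlib

section
/- The following explicit formulas hold for the q-commutators of the operators Ô₁,…,Ô₆: (i) [Ô₁,Ô₂]_q = Σ_{a,b∈{±1}} a·b·q^{1/4}t^{−1/2}·M_{(1−t^{1/2}X₂₃X₁₂^aX₁₃^b)(1−t^{1/2}X₂₃⁻¹X₁₂^aX₁₃^b)/(X₁₃^b(X₁₂−X₁₂⁻¹)(X₁₃−X₁₃⁻¹))} ∘ δ₁₂^a ∘ δ₁₃^b; (ii) [Ô₂,Ô₃]_q = Σ_{a,b∈{±1}} a·b·q^{−1/4}t^{−1/2}·M_{(1−t^{1/2}X₁₃X₁₂^aX₂₃^b)(1−t^{1/2}X₁₃⁻¹X₁₂^aX₂₃^b)/(X₁₂^{2a}X₂₃^b(X₂₃−X₂₃⁻¹)(X₁₂−X₁₂⁻¹))} ∘ δ₁₂^a ∘ δ₂₃^b; (iii) [[Ô₁,Ô₂]_q,Ô₃]_q = Σ_{a,b∈{±1}} a·b·M_{(1−t^{1/2}X₁₂X₂₃^aX₁₃^b)(1−t^{1/2}X₁₂⁻¹X₂₃^aX₁₃^b)/(t^{1/2}X₂₃^{2a}(X₁₃−X₁₃⁻¹)(X₂₃−X₂₃⁻¹))}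 ∘ δ₂₃^a ∘ δ₁₃^b. -/
set_option synthInstance.maxHeartbeats 1000000
set_option maxHeartbeats 4000000

noncomputable section

/-- The ground field `𝐤 = ℂ(q^{1/4}, t^{1/4})`. -/
abbrev kk : Type := FractionRing (MvPolynomial (Fin 2) ℂ)
/-- The field `K = 𝐤(X₁₂, X₂₃, X₁₃)`. -/
abbrev KK : Type := FractionRing (MvPolynomial (Fin 3) kk)

instance : Field kk := inferInstance
instance : Field KK := inferInstance
instance : Algebra kk KK := inferInstance

/-- `q^{1/4}`. -/
def q4 : kk := algebraMap (MvPolynomial (Fin 2) ℂ) kk (MvPolynomial.X 0)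
/-- `t^{1/4}`. -/
def t4 : kk := algebraMap (MvPolynomial (Fin 2) ℂ) kk (MvPolynomial.X 1)

def X12 : KK := algebraMap (MvPolynomial (Fin 3) kk) KK (MvPolynomial.X 0)
def X23 : KK := algebraMap (MvPolynomial (Fin 3) kk) KK (MvPolynomial.X 1)
def X13 : KK := algebraMap (MvPolynomial (Fin 3) kk) KK (MvPolynomial.X 2)

/-- `q^{1/2}` as an element of `K`. -/
def qh : KK := algebraMap kk KK (q4 ^ 2)
/-- `t^{1/2}` as an element of `K`. -/
def st : KK := algebraMap kk KK (t4 ^ 2)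

/-- Multiplication operator. -/
def Mop (g : KK) : Module.End kk KK := LinearMap.mulLeft kk g

/-- An algebra automorphism as a `𝐤`-linear endomorphism. -/
def Eop (δ : KK ≃ₐ[kk] KK) : Module.End kk KK := δ.toLinearMap

/-- Coefficient of `Ô₁` at `(a, b)`. -/
def c1 (a b : ℤ) : KK :=
  ((1 - st * X23 * X12 ^ a * X13 ^ b) * (1 - st * X23⁻¹ * X12 ^ a * X13 ^ b)) /
    (st * X12 ^ a * X13 ^ b * (X12 - X12⁻¹) * (X13 - X13⁻¹))

/-- Coefficient of `Ô₃` at `(a, b)`. -/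
def c3 (a b : ℤ) : KK :=
  ((1 - st * X13 * X12 ^ a * X23 ^ b) * (1 - st * X13⁻¹ * X12 ^ a * X23 ^ b)) /
    (st * X12 ^ a * X23 ^ b * (X12 - X12⁻¹) * (X23 - X23⁻¹))

/-- Coefficient of `Ô₅` at `(a, b)`. -/
def c5 (a b : ℤ) : KK :=
  ((1 - st * X12 * X13 ^ a * X23 ^ b) * (1 - st * X12⁻¹ * X13 ^ a * X23 ^ b)) /
    (st * X13 ^ a * X23 ^ b * (X13 - X13⁻¹) * (X23 - X23⁻¹))

/-- `Ô₁ = Σ_{a,b∈{±1}} a·b·M_{c1 a b} ∘ δ₁₂^a ∘ δ₁₃^b`. -/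
def Ohat1 (δ12 δ13 : KK ≃ₐ[kk] KK) : Module.End kk KK :=
  Mop (c1 1 1) * Eop δ12 * Eop δ13
  - Mop (c1 1 (-1)) * Eop δ12 * Eop δ13.symm
  - Mop (c1 (-1) 1) * Eop δ12.symm * Eop δ13
  + Mop (c1 (-1) (-1)) * Eop δ12.symm * Eop δ13.symm

/-- `Ô₂` : multiplication by `X₁₂ + X₁₂⁻¹`. -/
def Ohat2 : Module.End kk KK := Mop (X12 + X12⁻¹)

/-- `Ô₃ = Σ_{a,b∈{±1}} a·b·M_{c3 a b} ∘ δ₁₂^a ∘ δ₂₃^b`. -/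
def Ohat3 (δ12 δ23 : KK ≃ₐ[kk] KK) : Module.End kk KK :=
  Mop (c3 1 1) * Eop δ12 * Eop δ23
  - Mop (c3 1 (-1)) * Eop δ12 * Eop δ23.symm
  - Mop (c3 (-1) 1) * Eop δ12.symm * Eop δ23
  + Mop (c3 (-1) (-1)) * Eop δ12.symm * Eop δ23.symm

/-- `Ô₄` : multiplication by `X₂₃ + X₂₃⁻¹`. -/
def Ohat4 : Module.End kk KK := Mop (X23 + X23⁻¹)

/-- `Ô₅ = Σ_{a,b∈{±1}} a·b·M_{c5 a b} ∘ δ₁₃^a ∘ δ₂₃^b`. -/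
def Ohat5 (δ13 δ23 : KK ≃ₐ[kk] KK) : Module.End kk KK :=
  Mop (c5 1 1) * Eop δ13 * Eop δ23
  - Mop (c5 1 (-1)) * Eop δ13 * Eop δ23.symm
  - Mop (c5 (-1) 1) * Eop δ13.symm * Eop δ23
  + Mop (c5 (-1) (-1)) * Eop δ13.symm * Eop δ23.symm

/-- `Ô₆` : multiplication by `X₁₃ + X₁₃⁻¹`. -/
def Ohat6 : Module.End kk KK := Mop (X13 + X13⁻¹)

/-- The `q`-commutator `[A,B]_{q^j} = (q^{j/4}·A∘B − q^{−j/4}·B∘A)/(q^{1/2}−q^{−1/2})`. -/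
def qcomm (j : ℤ) (A B : Module.End kk KK) : Module.End kk KK :=
  (q4 ^ 2 - (q4 ^ 2)⁻¹)⁻¹ • ((q4 ^ j) • (A * B) - (q4 ^ j)⁻¹ • (B * A))

/-- Coefficient of `[Ô₁,Ô₂]_q` at `(a,b)` (including the prefactor `q^{1/4}t^{-1/2}`). -/
def d12 (a b : ℤ) : KK :=
  algebraMap kk KK (q4 * (t4 ^ 2)⁻¹) *
    (((1 - st * X23 * X12 ^ a * X13 ^ b) * (1 - st * X23⁻¹ * X12 ^ a * X13 ^ b)) /
      (X13 ^ b * (X12 - X12⁻¹) * (X13 - X13⁻¹)))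

/-- Coefficient of `[Ô₂,Ô₃]_q` at `(a,b)` (including the prefactor `q^{-1/4}t^{-1/2}`). -/
def d23 (a b : ℤ) : KK :=
  algebraMap kk KK (q4⁻¹ * (t4 ^ 2)⁻¹) *
    (((1 - st * X13 * X12 ^ a * X23 ^ b) * (1 - st * X13⁻¹ * X12 ^ a * X23 ^ b)) /
      (X12 ^ (2 * a) * X23 ^ b * (X23 - X23⁻¹) * (X12 - X12⁻¹)))

/-- Coefficient of `[[Ô₁,Ô₂]_q,Ô₃]_q` at `(a,b)`. -/
def d123 (a b : ℤ) : KK :=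
  ((1 - st * X12 * X23 ^ a * X13 ^ b) * (1 - st * X12⁻¹ * X23 ^ a * X13 ^ b)) /
    (st * X23 ^ (2 * a) * (X13 - X13⁻¹) * (X23 - X23⁻¹))

section ShiftOperators

variable {k F : Type*} [Field k] [Field F] [Algebra k F]

/-- The difference operator `v ↦ g * α v`. -/
def shiftOp (g : F) (α : F ≃ₐ[k] F) : Module.End k F :=
  LinearMap.mulLeft k g * α.toLinearMap

theorem shiftOp_apply (g : F) (α : F ≃ₐ[k] F) (v : F) : shiftOp g α v = g * α v := rfl

theorem neg_shiftOp (g : F) (α : F ≃ₐ[k] F) : -shiftOp g α = shiftOp (-g) α := by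
  ext v; simp [shiftOp_apply]

theorem shiftOp_mul (g h : F) (α β : F ≃ₐ[k] F) :
    shiftOp g α * shiftOp h β = shiftOp (g * α h) (α * β) := by
  ext v; simp [shiftOp_apply, mul_assoc]

/-- The `q`-commutator of two endomorphisms, with `s = q^{1/4}`. -/
def qCommutator (s : k) (A B : Module.End k F) : Module.End k F :=
  (s ^ 2 - (s ^ 2)⁻¹)⁻¹ • (s • (A * B) - s⁻¹ • (B * A))

theorem qCommutator_apply (s : k) (A B : Module.End k F) (v : F) :
    qCommutator s A B v =
      (algebraMap k F s ^ 2 - (algebraMap k F s ^ 2)⁻¹)⁻¹ *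
        (algebraMap k F s * (A * B) v - (algebraMap k F s)⁻¹ * (B * A) v) := by
  rw [qCommutator, LinearMap.smul_apply, LinearMap.sub_apply, LinearMap.smul_apply,
    LinearMap.smul_apply]
  simp only [Algebra.smul_def, map_inv₀, map_sub, map_pow]

theorem qCommutator_add_left (s : k) (A A' B : Module.End k F) :
    qCommutator s (A + A') B = qCommutator s A B + qCommutator s A' B := by
  simp only [qCommutator, add_mul, mul_add, smul_add, smul_sub]; abel

theorem qCommutator_add_right (s : k) (A B B' : Module.End k F) :
    qCommutator s A (B + B') = qCommutator s A B + qCommutator s A B' := by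
  simp only [qCommutator, add_mul, mul_add, smul_add, smul_sub]; abel

theorem algebraMap_sq_sub_inv_ne_zero {s : k} (hs : s ^ 2 - (s ^ 2)⁻¹ ≠ 0) :
    algebraMap k F s ^ 2 - (algebraMap k F s ^ 2)⁻¹ ≠ 0 := by
  have := (map_ne_zero (algebraMap k F)).2 hs
  simpa using this

theorem qCommutator_shiftOp_mulLeft {s : k} (hs0 : s ≠ 0) (hs : s ^ 2 - (s ^ 2)⁻¹ ≠ 0)
    {x : F} {α : F ≃ₐ[k] F} (hx : α x = algebraMap k F s ^ 2 * x) (g : F) :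
    qCommutator s (shiftOp g α) (LinearMap.mulLeft k (x + x⁻¹)) =
      shiftOp (algebraMap k F s * x * g) α := by
  have hs' := algebraMap_sq_sub_inv_ne_zero (F := F) hs
  have hs0' := (map_ne_zero (algebraMap k F)).2 hs0
  ext v
  simp only [qCommutator_apply, Module.End.mul_apply, shiftOp_apply, LinearMap.mulLeft_apply,
    map_mul, map_add, map_inv₀, hx]
  generalize algebraMap k F s = S at *
  rw [inv_mul_eq_iff_eq_mul₀ hs', mul_inv]
  generalize x⁻¹ = x'
  field_simp
  ring

theorem qCommutator_mulLeft_shiftOp {s : k} (hs0 : s ≠ 0) (hs : s ^ 2 - (s ^ 2)⁻¹ ≠ 0)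
    {x : F} {α : F ≃ₐ[k] F} (hx : α x = algebraMap k F s ^ 2 * x) (g : F) :
    qCommutator s (LinearMap.mulLeft k (x + x⁻¹)) (shiftOp g α) =
      shiftOp ((algebraMap k F s)⁻¹ * x⁻¹ * g) α := by
  have hs' := algebraMap_sq_sub_inv_ne_zero (F := F) hs
  have hs0' := (map_ne_zero (algebraMap k F)).2 hs0
  ext v
  simp only [qCommutator_apply, Module.End.mul_apply, shiftOp_apply, LinearMap.mulLeft_apply,
    map_mul, map_add, map_inv₀, hx]
  generalize algebraMap k F s = S at *
  rw [inv_mul_eq_iff_eq_mul₀ hs', mul_inv]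
  generalize x⁻¹ = x'
  field_simp
  ring

/-- The coefficient shared by all terms of `Ô₁` and `Ô₃`. -/
def shiftCoeff (t x y z : F) : F :=
  (1 - t * y * x * z) * (1 - t * y⁻¹ * x * z) / (t * x * z * (x - x⁻¹) * (z - z⁻¹))

theorem shiftCoeff_inv_middle (t x y z : F) : shiftCoeff t x y⁻¹ z = shiftCoeff t x y z := by
  simp only [shiftCoeff, inv_inv]; ring

theorem map_shiftCoeff (α : F ≃ₐ[k] F) (t x y z : F) :
    α (shiftCoeff t x y z) = shiftCoeff (α t) (α x) (α y) (α z) := by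
  simp [shiftCoeff]

/-- The coefficient at `(a, b)`, without the sign `a * b`, of the operators `Ô₁`, `Ô₃`. -/
def signedCoeff (t x y z : F) (a b : ℤ) : F :=
  (1 - t * y * x ^ a * z ^ b) * (1 - t * y⁻¹ * x ^ a * z ^ b) /
    (t * x ^ a * z ^ b * (x - x⁻¹) * (z - z⁻¹))

theorem inv_inv_sub_self (x : F) : (x⁻¹ - x)⁻¹ = -(x - x⁻¹)⁻¹ := by
  rw [← neg_sub, inv_neg]

theorem signedCoeff_one_one (t x y z : F) : signedCoeff t x y z 1 1 = shiftCoeff t x y z := by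
  simp only [signedCoeff, shiftCoeff, zpow_one]

theorem signedCoeff_one_neg_one (t x y z : F) :
    signedCoeff t x y z 1 (-1) = -shiftCoeff t x y z⁻¹ := by
  simp only [signedCoeff, shiftCoeff, zpow_one, zpow_neg, inv_inv, div_eq_mul_inv, mul_inv,
    inv_inv_sub_self]
  ring

theorem signedCoeff_neg_one_one (t x y z : F) :
    signedCoeff t x y z (-1) 1 = -shiftCoeff t x⁻¹ y z := by
  simp only [signedCoeff, shiftCoeff, zpow_one, zpow_neg, inv_inv, div_eq_mul_inv, mul_inv,
    inv_inv_sub_self]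
  ring

theorem signedCoeff_neg_one_neg_one (t x y z : F) :
    signedCoeff t x y z (-1) (-1) = shiftCoeff t x⁻¹ y z⁻¹ := by
  simp only [signedCoeff, shiftCoeff, zpow_one, zpow_neg, inv_inv, div_eq_mul_inv, mul_inv,
    inv_inv_sub_self]
  ring

theorem aut_inv_apply_of_fixed {α : F ≃ₐ[k] F} {x : F} (h : α x = x) : α⁻¹ x = x := by
  rw [AlgEquiv.aut_inv, AlgEquiv.symm_apply_eq, h]

theorem aut_inv_apply_inv {α : F ≃ₐ[k] F} {x : F} {s : k} (hs : s ≠ 0)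
    (h : α x = algebraMap k F s ^ 2 * x) : α⁻¹ x⁻¹ = algebraMap k F s ^ 2 * x⁻¹ := by
  have hs0' := (map_ne_zero (algebraMap k F)).2 hs
  rw [AlgEquiv.aut_inv, AlgEquiv.symm_apply_eq, map_mul, map_inv₀, h, map_pow, AlgEquiv.commutes,
    mul_inv, mul_inv_cancel_left₀ (pow_ne_zero 2 hs0')]

theorem aut_apply_inv_of_fixed {α : F ≃ₐ[k] F} {x : F} (h : α x = x) : α x⁻¹ = x⁻¹ := by
  rw [map_inv₀, h]

theorem inv_sq_ne_one {x : F} (h : x ^ 2 ≠ 1) : x⁻¹ ^ 2 ≠ 1 := by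
  rwa [inv_pow, inv_ne_one]

theorem shiftCoeff_eq {t x y z : F} (hx0 : x ≠ 0) (hy0 : y ≠ 0) (hz0 : z ≠ 0) :
    shiftCoeff t x y z =
      (1 - t * y * x * z) * (y - t * x * z) / (t * y * (x ^ 2 - 1) * (z ^ 2 - 1)) := by
  have h : (1 - t * y⁻¹ * x * z) = (y - t * x * z) / y := by field_simp
  have h1 : x * (x - x⁻¹) = x ^ 2 - 1 := by field_simp
  have h2 : z * (z - z⁻¹) = z ^ 2 - 1 := by field_simp
  have h3 : t * x * z * (x - x⁻¹) * (z - z⁻¹) = t * (x ^ 2 - 1) * (z ^ 2 - 1) := by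
    rw [← h1, ← h2]; ring
  rw [shiftCoeff, h, h3, ← mul_div_assoc, div_div]
  congr 1; ring

theorem shiftCoeff_mul_shift {t q x y z : F} (hq : q ≠ 0) (hx0 : x ≠ 0) (hy0 : y ≠ 0)
    (hz0 : z ≠ 0) :
    shiftCoeff t x y z * shiftCoeff t (q * x) (q * z) y =
      shiftCoeff t x z y * shiftCoeff t (q * x) (q * y) z := by
  have hqx := mul_ne_zero hq hx0
  rw [shiftCoeff_eq hx0 hy0 hz0, shiftCoeff_eq hqx (mul_ne_zero hq hz0) hy0,
    shiftCoeff_eq hx0 hz0 hy0, shiftCoeff_eq hqx (mul_ne_zero hq hy0) hz0, div_mul_div_comm,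
    div_mul_div_comm]
  congr 1 <;> ring

theorem shiftCoeff_opposite_shifts {t q x y z : F} (ht : t ≠ 0) (hq : q ≠ 0) (hx0 : x ≠ 0)
    (hy0 : y ≠ 0) (hz0 : z ≠ 0) (hx : x ^ 2 ≠ 1) (hqx : (q * x) ^ 2 ≠ 1) (hxq : x ^ 2 ≠ q ^ 2)
    (hy : y ^ 2 ≠ 1) (hz : z ^ 2 ≠ 1) :
    q * x * shiftCoeff t x y z * shiftCoeff t (q⁻¹ * x⁻¹) (q * z) y
      - shiftCoeff t x⁻¹ z y * (q⁻¹ * x * shiftCoeff t (q⁻¹ * x) (q * y) z)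
      + (q * x⁻¹ * shiftCoeff t x⁻¹ y z * shiftCoeff t (q⁻¹ * x) (q * z) y
      - shiftCoeff t x z y * (q⁻¹ * x⁻¹ * shiftCoeff t (q⁻¹ * x⁻¹) (q * y) z)) =
    (q - q⁻¹) * (z * y⁻¹ * shiftCoeff t y x z) := by
  have hqi := inv_ne_zero hq
  have hxi := inv_ne_zero hx0
  have e1 : x ^ 2 - 1 ≠ 0 := sub_ne_zero.2 hx
  have e2 : y ^ 2 - 1 ≠ 0 := sub_ne_zero.2 hy
  have e3 : z ^ 2 - 1 ≠ 0 := sub_ne_zero.2 hz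
  have e4 : q ^ 2 * x ^ 2 - 1 ≠ 0 := by rw [← mul_pow]; exact sub_ne_zero.2 hqx
  have e5 : x ^ 2 - q ^ 2 ≠ 0 := sub_ne_zero.2 hxq
  have f1 : x⁻¹ ^ 2 - 1 = -(x ^ 2 - 1) / x ^ 2 := by field_simp; ring
  have f2 : (q⁻¹ * x⁻¹) ^ 2 - 1 = -(q ^ 2 * x ^ 2 - 1) / (q ^ 2 * x ^ 2) := by field_simp; ring
  have f3 : (q⁻¹ * x) ^ 2 - 1 = (x ^ 2 - q ^ 2) / q ^ 2 := by field_simp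
  rw [shiftCoeff_eq hx0 hy0 hz0, shiftCoeff_eq (mul_ne_zero hqi hxi) (mul_ne_zero hq hz0) hy0,
    shiftCoeff_eq hxi hz0 hy0, shiftCoeff_eq (mul_ne_zero hqi hx0) (mul_ne_zero hq hy0) hz0,
    shiftCoeff_eq hxi hy0 hz0, shiftCoeff_eq (mul_ne_zero hqi hx0) (mul_ne_zero hq hz0) hy0,
    shiftCoeff_eq hx0 hz0 hy0, shiftCoeff_eq (mul_ne_zero hqi hxi) (mul_ne_zero hq hy0) hz0,
    shiftCoeff_eq hy0 hx0 hz0, f1, f2, f3]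
  generalize hX : x ^ 2 - 1 = X at *
  generalize hY : y ^ 2 - 1 = Y at *
  generalize hZ : z ^ 2 - 1 = Z at *
  generalize hU : q ^ 2 * x ^ 2 - 1 = U at *
  generalize hV : x ^ 2 - q ^ 2 = V at *
  field_simp
  subst hX hY hZ hU hV
  ring

theorem qCommutator_shiftOp_add_shiftOp {s t : k} (hs0 : s ≠ 0) (hs : s ^ 2 - (s ^ 2)⁻¹ ≠ 0)
    (ht : t ≠ 0) {x y z : F} {δ σ τ : F ≃ₐ[k] F}
    (hδσ : Commute δ σ) (hδτ : Commute δ τ) (hστ : Commute σ τ)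
    (hδx : δ x = algebraMap k F s ^ 2 * x) (hδy : δ y = y) (hδz : δ z = z)
    (hσx : σ x = x) (hσy : σ y = y) (hσz : σ z = algebraMap k F s ^ 2 * z)
    (hτx : τ x = x) (hτy : τ y = algebraMap k F s ^ 2 * y) (hτz : τ z = z)
    (hx0 : x ≠ 0) (hy0 : y ≠ 0) (hz0 : z ≠ 0) (hx : x ^ 2 ≠ 1)
    (hqx : (algebraMap k F s ^ 2 * x) ^ 2 ≠ 1) (hxq : x ^ 2 ≠ (algebraMap k F s ^ 2) ^ 2)
    (hy : y ^ 2 ≠ 1) (hz : z ^ 2 ≠ 1) :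
    qCommutator s
      (shiftOp (algebraMap k F s * x * shiftCoeff (algebraMap k F t) x y z) (δ * σ) +
        shiftOp (algebraMap k F s * x⁻¹ * shiftCoeff (algebraMap k F t) x⁻¹ y z) (δ⁻¹ * σ))
      (shiftOp (shiftCoeff (algebraMap k F t) x z y) (δ * τ) +
        shiftOp (shiftCoeff (algebraMap k F t) x⁻¹ z y) (δ⁻¹ * τ)) =
      shiftOp (z * y⁻¹ * shiftCoeff (algebraMap k F t) y x z) (τ * σ) := by
  have hs' := algebraMap_sq_sub_inv_ne_zero (F := F) hs
  have hs0' := (map_ne_zero (algebraMap k F)).2 hs0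
  have ht' := (map_ne_zero (algebraMap k F)).2 ht
  have hδx' : δ⁻¹ x = (algebraMap k F s ^ 2)⁻¹ * x := by
    have := congrArg Inv.inv (aut_inv_apply_inv hs0 hδx)
    rwa [map_inv₀, inv_inv, mul_inv, inv_inv] at this
  have hδy' := aut_inv_apply_of_fixed hδy
  have hδz' := aut_inv_apply_of_fixed hδz
  have e1 : δ * σ * (δ * τ) = δ * δ * (τ * σ) := by
    rw [mul_assoc, ← mul_assoc σ, ← hδσ.eq, mul_assoc δ σ, hστ.eq, mul_assoc]
  have e1' : δ * τ * (δ * σ) = δ * δ * (τ * σ) := by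
    rw [mul_assoc, ← mul_assoc τ, ← hδτ.eq]; simp only [mul_assoc]
  have e2 : δ⁻¹ * σ * (δ⁻¹ * τ) = δ⁻¹ * δ⁻¹ * (τ * σ) := by
    rw [mul_assoc, ← mul_assoc σ, ← hδσ.inv_left.eq, mul_assoc δ⁻¹ σ, hστ.eq, mul_assoc]
  have e2' : δ⁻¹ * τ * (δ⁻¹ * σ) = δ⁻¹ * δ⁻¹ * (τ * σ) := by
    rw [mul_assoc, ← mul_assoc τ, ← hδτ.inv_left.eq]; simp only [mul_assoc]
  have e3 : δ * σ * (δ⁻¹ * τ) = τ * σ := by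
    rw [mul_assoc, ← mul_assoc σ, ← hδσ.inv_left.eq, mul_assoc δ⁻¹, mul_inv_cancel_left, hστ.eq]
  have e3' : δ * τ * (δ⁻¹ * σ) = τ * σ := by
    rw [mul_assoc, ← mul_assoc τ, ← hδτ.inv_left.eq, mul_assoc δ⁻¹, mul_inv_cancel_left]
  have e4 : δ⁻¹ * σ * (δ * τ) = τ * σ := by
    rw [mul_assoc, ← mul_assoc σ, ← hδσ.eq, mul_assoc δ, inv_mul_cancel_left, hστ.eq]
  have e4' : δ⁻¹ * τ * (δ * σ) = τ * σ := by
    rw [mul_assoc, ← mul_assoc τ, ← hδτ.eq, mul_assoc δ, inv_mul_cancel_left]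
  have hq0 : algebraMap k F s ^ 2 ≠ 0 := pow_ne_zero 2 hs0'
  have i1 := shiftCoeff_mul_shift (t := algebraMap k F t) hq0 hx0 hy0 hz0
  have i2 := shiftCoeff_mul_shift (t := algebraMap k F t) hq0 (inv_ne_zero hx0) hy0 hz0
  have i3 := shiftCoeff_opposite_shifts ht' hq0 hx0 hy0 hz0 hx hqx hxq hy hz
  ext v
  simp only [qCommutator_apply, add_mul, mul_add, shiftOp_mul, e1, e1', e2, e2', e3, e3', e4, e4']
  simp only [LinearMap.add_apply, shiftOp_apply, AlgEquiv.mul_apply, map_mul, map_inv₀, map_pow,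
    map_shiftCoeff, AlgEquiv.commutes, hδx, hδy, hδz, hσx, hσy, hσz, hτx, hτy, hτz, hδx', hδy', hδz', mul_inv,
    inv_inv]
  simp only [← mul_inv]
  rw [inv_mul_eq_iff_eq_mul₀ hs']
  simp only [mul_inv] at i3 ⊢
  generalize δ (δ (τ (σ v))) = v1
  generalize δ⁻¹ (δ⁻¹ (τ (σ v))) = v2
  generalize τ (σ v) = v0
  generalize algebraMap k F s = S at *
  generalize algebraMap k F t = T at *
  have hS : S⁻¹ * S = 1 := inv_mul_cancel₀ hs0'
  linear_combination S ^ 2 * x * v1 * i1 + S ^ 2 * x⁻¹ * v2 * i2 + v0 * i3 -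
    (S ^ 2 * x * v1 * shiftCoeff T x z y * shiftCoeff T (S ^ 2 * x) (S ^ 2 * y) z +
      S ^ 2 * x⁻¹ * v2 * shiftCoeff T x⁻¹ z y * shiftCoeff T (S ^ 2 * x⁻¹) (S ^ 2 * y) z +
      x * v0 * S⁻¹ ^ 2 * shiftCoeff T x⁻¹ z y * shiftCoeff T ((S ^ 2)⁻¹ * x) (S ^ 2 * y) z +
      x⁻¹ * v0 * S⁻¹ ^ 2 * shiftCoeff T x z y *
        shiftCoeff T ((S ^ 2)⁻¹ * x⁻¹) (S ^ 2 * y) z) * hS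

end ShiftOperators

theorem MvPolynomial.X_pow_ne_C {R ι : Type*} [CommSemiring R] [Nontrivial R] (i : ι) {n : ℕ}
    (hn : n ≠ 0) (c : R) : (MvPolynomial.X i : MvPolynomial ι R) ^ n ≠ MvPolynomial.C c := by
  intro h
  have := congrArg MvPolynomial.totalDegree h
  rw [MvPolynomial.totalDegree_X_pow, MvPolynomial.totalDegree_C] at this
  exact hn this

theorem algebraMap_X_pow_ne {R ι : Type*} [CommRing R] [IsDomain R] (i : ι) {n : ℕ}
    (hn : n ≠ 0) (c : R) :
    (algebraMap (MvPolynomial ι R) (FractionRing (MvPolynomial ι R)) (MvPolynomial.X i)) ^ n ≠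
      algebraMap (MvPolynomial ι R) (FractionRing (MvPolynomial ι R)) (MvPolynomial.C c) := by
  rw [← map_pow]
  exact fun h => MvPolynomial.X_pow_ne_C i hn c (IsFractionRing.injective _ _ h)

theorem algebraMap_X_pow_ne_one {R ι : Type*} [CommRing R] [IsDomain R] (i : ι) {n : ℕ}
    (hn : n ≠ 0) :
    (algebraMap (MvPolynomial ι R) (FractionRing (MvPolynomial ι R)) (MvPolynomial.X i)) ^ n ≠
      1 := by
  simpa using algebraMap_X_pow_ne i hn (1 : R)

theorem algebraMap_X_ne_zero {R ι : Type*} [CommRing R] [IsDomain R] (i : ι) :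
    (algebraMap (MvPolynomial ι R) (FractionRing (MvPolynomial ι R)) (MvPolynomial.X i)) ≠
      0 := by
  simp

theorem algEquiv_fractionRing_mvPolynomial_ext {R ι : Type*} [Field R]
    {f g : FractionRing (MvPolynomial ι R) ≃ₐ[R] FractionRing (MvPolynomial ι R)}
    (h : ∀ i, f (algebraMap (MvPolynomial ι R) _ (MvPolynomial.X i)) =
      g (algebraMap (MvPolynomial ι R) _ (MvPolynomial.X i))) : f = g := by
  have key : (f : _ →ₐ[R] FractionRing (MvPolynomial ι R)).comp
        (IsScalarTower.toAlgHom R (MvPolynomial ι R) (FractionRing (MvPolynomial ι R))) =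
      (g : _ →ₐ[R] FractionRing (MvPolynomial ι R)).comp
        (IsScalarTower.toAlgHom R (MvPolynomial ι R) (FractionRing (MvPolynomial ι R))) :=
    MvPolynomial.algHom_ext fun i => by simpa using h i
  have key' (p : MvPolynomial ι R) : f (algebraMap _ _ p) = g (algebraMap _ _ p) := by
    simpa using DFunLike.congr_fun key p
  ext v
  obtain ⟨a, b, -, rfl⟩ := IsFractionRing.div_surjective (A := MvPolynomial ι R) v
  rw [map_div₀, map_div₀, key', key']

theorem q4_ne_zero : q4 ≠ 0 := algebraMap_X_ne_zero 0

theorem t4_ne_zero : t4 ≠ 0 := algebraMap_X_ne_zero 1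

theorem q4_sq_sub_inv_ne_zero : q4 ^ 2 - (q4 ^ 2)⁻¹ ≠ 0 := by
  intro h
  have h4 : q4 ^ 4 ≠ 1 := algebraMap_X_pow_ne_one 0 four_ne_zero
  apply h4
  have h2 : q4 ^ 2 * (q4 ^ 2)⁻¹ = 1 := mul_inv_cancel₀ (pow_ne_zero 2 q4_ne_zero)
  linear_combination q4 ^ 2 * h + h2

theorem X12_ne_zero : X12 ≠ 0 := algebraMap_X_ne_zero 0

theorem X23_ne_zero : X23 ≠ 0 := algebraMap_X_ne_zero 1

theorem X13_ne_zero : X13 ≠ 0 := algebraMap_X_ne_zero 2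

theorem X12_sq_ne_algebraMap (c : kk) : X12 ^ 2 ≠ algebraMap kk KK c := by
  rw [IsScalarTower.algebraMap_apply kk (MvPolynomial (Fin 3) kk) KK]
  exact algebraMap_X_pow_ne 0 two_ne_zero c

theorem algEquiv_KK_ext {f g : KK ≃ₐ[kk] KK} (h12 : f X12 = g X12) (h23 : f X23 = g X23)
    (h13 : f X13 = g X13) : f = g := by
  refine algEquiv_fractionRing_mvPolynomial_ext fun i => ?_
  fin_cases i
  exacts [h12, h23, h13]

theorem X23_sq_ne_one : X23 ^ 2 ≠ 1 := algebraMap_X_pow_ne_one 1 two_ne_zero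

theorem X13_sq_ne_one : X13 ^ 2 ≠ 1 := algebraMap_X_pow_ne_one 2 two_ne_zero

theorem qh_eq : qh = algebraMap kk KK q4 ^ 2 := map_pow _ _ _

theorem Mop_mul_Eop_mul_Eop (g : KK) (α β : KK ≃ₐ[kk] KK) :
    Mop g * Eop α * Eop β = shiftOp g (α * β) := rfl

theorem qcomm_one (A B : Module.End kk KK) : qcomm 1 A B = qCommutator q4 A B := by
  rw [qcomm, qCommutator, zpow_one]

theorem signed_sum_eq (c : ℤ → ℤ → KK) (α β : KK ≃ₐ[kk] KK) :
    Mop (c 1 1) * Eop α * Eop β - Mop (c 1 (-1)) * Eop α * Eop β.symm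
        - Mop (c (-1) 1) * Eop α.symm * Eop β + Mop (c (-1) (-1)) * Eop α.symm * Eop β.symm =
      shiftOp (c 1 1) (α * β) + shiftOp (-c (-1) 1) (α⁻¹ * β) +
        (shiftOp (-c 1 (-1)) (α * β⁻¹) + shiftOp (c (-1) (-1)) (α⁻¹ * β⁻¹)) := by
  simp only [Mop_mul_Eop_mul_Eop, ← neg_shiftOp, AlgEquiv.aut_inv]
  abel

theorem c1_eq : c1 = signedCoeff st X12 X23 X13 := rfl

theorem c3_eq : c3 = signedCoeff st X12 X13 X23 := rfl

theorem d12_eq (a b : ℤ) : d12 a b = algebraMap kk KK q4 * X12 ^ a * c1 a b := by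
  have hA := mul_inv_cancel₀ (zpow_ne_zero a X12_ne_zero)
  have ht : algebraMap kk KK (q4 * (t4 ^ 2)⁻¹) = algebraMap kk KK q4 * st⁻¹ := by
    rw [map_mul, map_inv₀, st]
  rw [d12, c1, ht]
  generalize (1 - st * X23 * X12 ^ a * X13 ^ b) * (1 - st * X23⁻¹ * X12 ^ a * X13 ^ b) = N
  generalize (X12 - X12⁻¹) = u, (X13 - X13⁻¹) = v
  generalize X12 ^ a = A at *
  simp only [div_eq_mul_inv, mul_inv]
  linear_combination -(algebraMap kk KK q4 * st⁻¹ * N * (X13 ^ b)⁻¹ * u⁻¹ * v⁻¹) * hA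

theorem d23_eq (a b : ℤ) :
    d23 a b = (algebraMap kk KK q4)⁻¹ * (X12 ^ a)⁻¹ * c3 a b := by
  have ht : algebraMap kk KK (q4⁻¹ * (t4 ^ 2)⁻¹) = (algebraMap kk KK q4)⁻¹ * st⁻¹ := by
    rw [map_mul, map_inv₀, map_inv₀, st]
  rw [d23, c3, ht, two_mul, zpow_add₀ X12_ne_zero]
  generalize (1 - st * X13 * X12 ^ a * X23 ^ b) * (1 - st * X13⁻¹ * X12 ^ a * X23 ^ b) = N
  generalize (X12 - X12⁻¹) = u, (X23 - X23⁻¹) = v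
  generalize X12 ^ a = A at *
  simp only [div_eq_mul_inv, mul_inv]
  ring

theorem d123_eq (a b : ℤ) :
    d123 a b = X13 ^ b * (X23 ^ a)⁻¹ * signedCoeff st X23 X12 X13 a b := by
  have hB := mul_inv_cancel₀ (zpow_ne_zero b X13_ne_zero)
  rw [d123, signedCoeff, two_mul, zpow_add₀ X23_ne_zero]
  generalize (1 - st * X12 * X23 ^ a * X13 ^ b) * (1 - st * X12⁻¹ * X23 ^ a * X13 ^ b) = N
  generalize (X23 - X23⁻¹) = u, (X13 - X13⁻¹) = v
  generalize X23 ^ a = A at *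
  generalize X13 ^ b = B at *
  simp only [div_eq_mul_inv, mul_inv]
  linear_combination -(st⁻¹ * N * A⁻¹ * A⁻¹ * u⁻¹ * v⁻¹) * hB

/-- explicit `q`-difference-operator formulas for `[Ô₁,Ô₂]_q`, `[Ô₂,Ô₃]_q`
and `[[Ô₁,Ô₂]_q,Ô₃]_q`. -/
theorem explicit_qcomm_formulas
    (δ12 δ23 δ13 : KK ≃ₐ[kk] KK)
    (h12x : δ12 X12 = qh * X12) (h12y : δ12 X23 = X23) (h12z : δ12 X13 = X13)
    (h23x : δ23 X12 = X12) (h23y : δ23 X23 = qh * X23) (h23z : δ23 X13 = X13)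
    (h13x : δ13 X12 = X12) (h13y : δ13 X23 = X23) (h13z : δ13 X13 = qh * X13) :
    qcomm 1 (Ohat1 δ12 δ13) Ohat2
      = Mop (d12 1 1) * Eop δ12 * Eop δ13
        - Mop (d12 1 (-1)) * Eop δ12 * Eop δ13.symm
        - Mop (d12 (-1) 1) * Eop δ12.symm * Eop δ13
        + Mop (d12 (-1) (-1)) * Eop δ12.symm * Eop δ13.symm ∧
    qcomm 1 Ohat2 (Ohat3 δ12 δ23)
      = Mop (d23 1 1) * Eop δ12 * Eop δ23
        - Mop (d23 1 (-1)) * Eop δ12 * Eop δ23.symm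
        - Mop (d23 (-1) 1) * Eop δ12.symm * Eop δ23
        + Mop (d23 (-1) (-1)) * Eop δ12.symm * Eop δ23.symm ∧
    qcomm 1 (qcomm 1 (Ohat1 δ12 δ13) Ohat2) (Ohat3 δ12 δ23)
      = Mop (d123 1 1) * Eop δ23 * Eop δ13
        - Mop (d123 1 (-1)) * Eop δ23 * Eop δ13.symm
        - Mop (d123 (-1) 1) * Eop δ23.symm * Eop δ13
        + Mop (d123 (-1) (-1)) * Eop δ23.symm * Eop δ13.symm := by
  rw [qh_eq] at h12x h23y h13z
  have hq0 := q4_ne_zero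
  have hq := q4_sq_sub_inv_ne_zero
  have comm12_13 : Commute δ12 δ13 := algEquiv_KK_ext
    (by simp only [AlgEquiv.mul_apply, h12x, h13x, map_mul, map_pow, AlgEquiv.commutes])
    (by simp only [AlgEquiv.mul_apply, h12y, h13y])
    (by simp only [AlgEquiv.mul_apply, h12z, h13z, map_mul, map_pow, AlgEquiv.commutes])
  have comm12_23 : Commute δ12 δ23 := algEquiv_KK_ext
    (by simp only [AlgEquiv.mul_apply, h12x, h23x, map_mul, map_pow, AlgEquiv.commutes])
    (by simp only [AlgEquiv.mul_apply, h12y, h23y, map_mul, map_pow, AlgEquiv.commutes])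
    (by simp only [AlgEquiv.mul_apply, h12z, h23z])
  have comm13_23 : Commute δ13 δ23 := algEquiv_KK_ext
    (by simp only [AlgEquiv.mul_apply, h13x, h23x])
    (by simp only [AlgEquiv.mul_apply, h13y, h23y, map_mul, map_pow, AlgEquiv.commutes])
    (by simp only [AlgEquiv.mul_apply, h13z, h23z, map_mul, map_pow, AlgEquiv.commutes])
  have h12x' := aut_inv_apply_inv hq0 h12x
  have h23y' := aut_inv_apply_inv hq0 h23y
  have h13z' := aut_inv_apply_inv hq0 h13z
  have h23x' := aut_inv_apply_of_fixed h23x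
  have h23z' := aut_inv_apply_of_fixed h23z
  have h13x' := aut_inv_apply_of_fixed h13x
  have h13y' := aut_inv_apply_of_fixed h13y
  have hO1 : Ohat1 δ12 δ13 = _ := signed_sum_eq c1 δ12 δ13
  have hO3 : Ohat3 δ12 δ23 = _ := signed_sum_eq c3 δ12 δ23
  have hO2 : Ohat2 = LinearMap.mulLeft kk (X12 + X12⁻¹) := rfl
  have hO2' : Ohat2 = LinearMap.mulLeft kk (X12⁻¹ + X12⁻¹⁻¹) := by rw [hO2, inv_inv, add_comm]
  rw [c1_eq] at hO1
  rw [c3_eq] at hO3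
  simp only [signedCoeff_one_one, signedCoeff_one_neg_one, signedCoeff_neg_one_one,
    signedCoeff_neg_one_neg_one, neg_neg] at hO1 hO3
  rw [signed_sum_eq d12, signed_sum_eq d23, signed_sum_eq d123]
  simp only [d12_eq, d23_eq, d123_eq,
    c1_eq, c3_eq, signedCoeff_one_one, signedCoeff_one_neg_one, signedCoeff_neg_one_one,
    signedCoeff_neg_one_neg_one, zpow_neg, zpow_one, mul_neg, neg_neg, qcomm_one]
  have h12 : qCommutator q4 (Ohat1 δ12 δ13) Ohat2 =
      shiftOp (algebraMap kk KK q4 * X12 * shiftCoeff st X12 X23 X13) (δ12 * δ13) +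
      shiftOp (algebraMap kk KK q4 * X12⁻¹ * shiftCoeff st X12⁻¹ X23 X13) (δ12⁻¹ * δ13) +
      (shiftOp (algebraMap kk KK q4 * X12 * shiftCoeff st X12 X23 X13⁻¹) (δ12 * δ13⁻¹) +
      shiftOp (algebraMap kk KK q4 * X12⁻¹ * shiftCoeff st X12⁻¹ X23 X13⁻¹)
        (δ12⁻¹ * δ13⁻¹)) := by
    rw [hO1, qCommutator_add_left, qCommutator_add_left, qCommutator_add_left, hO2,
      qCommutator_shiftOp_mulLeft hq0 hq (x := X12) (α := δ12 * δ13)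
        (by rw [AlgEquiv.mul_apply, h13x, h12x]),
      qCommutator_shiftOp_mulLeft hq0 hq (x := X12) (α := δ12 * δ13⁻¹)
        (by rw [AlgEquiv.mul_apply, h13x', h12x]),
      ← hO2, hO2',
      qCommutator_shiftOp_mulLeft hq0 hq (x := X12⁻¹) (α := δ12⁻¹ * δ13)
        (by rw [AlgEquiv.mul_apply, aut_apply_inv_of_fixed h13x, h12x']),
      qCommutator_shiftOp_mulLeft hq0 hq (x := X12⁻¹) (α := δ12⁻¹ * δ13⁻¹)
        (by rw [AlgEquiv.mul_apply, aut_apply_inv_of_fixed h13x', h12x'])]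
  refine ⟨h12, ?_, ?_⟩
  · rw [hO3, qCommutator_add_right, qCommutator_add_right, qCommutator_add_right, hO2,
      qCommutator_mulLeft_shiftOp hq0 hq (x := X12) (α := δ12 * δ23)
        (by rw [AlgEquiv.mul_apply, h23x, h12x]),
      qCommutator_mulLeft_shiftOp hq0 hq (x := X12) (α := δ12 * δ23⁻¹)
        (by rw [AlgEquiv.mul_apply, h23x', h12x]),
      ← hO2, hO2',
      qCommutator_mulLeft_shiftOp hq0 hq (x := X12⁻¹) (α := δ12⁻¹ * δ23)
        (by rw [AlgEquiv.mul_apply, aut_apply_inv_of_fixed h23x, h12x']),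
      qCommutator_mulLeft_shiftOp hq0 hq (x := X12⁻¹) (α := δ12⁻¹ * δ23⁻¹)
        (by rw [AlgEquiv.mul_apply, aut_apply_inv_of_fixed h23x', h12x'])]
  · have ht : t4 ^ 2 ≠ 0 := pow_ne_zero 2 t4_ne_zero
    have hx : X12 ^ 2 ≠ 1 := by simpa only [map_one] using X12_sq_ne_algebraMap 1
    have hxq : X12 ^ 2 ≠ (algebraMap kk KK q4 ^ 2) ^ 2 := by
      rw [← map_pow, ← map_pow]
      exact X12_sq_ne_algebraMap _
    have hqx : (algebraMap kk KK q4 ^ 2 * X12) ^ 2 ≠ 1 := by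
      intro h
      apply X12_sq_ne_algebraMap ((q4 ^ 2) ^ 2)⁻¹
      rw [map_inv₀, map_pow, map_pow]
      rw [mul_pow] at h
      exact eq_inv_of_mul_eq_one_right h
    have hy := X23_sq_ne_one
    have hz := X13_sq_ne_one
    have hy' := inv_sq_ne_one hy
    have hz' := inv_sq_ne_one hz
    have hx0 := X12_ne_zero
    have hy0 := X23_ne_zero
    have hz0 := X13_ne_zero
    have hy0' := inv_ne_zero hy0
    have hz0' := inv_ne_zero hz0
    have p1 := qCommutator_shiftOp_add_shiftOp hq0 hq ht comm12_13 comm12_23 comm13_23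
      h12x h12y h12z h13x h13y h13z h23x h23y h23z hx0 hy0 hz0 hx hqx hxq hy hz
    have p2 := qCommutator_shiftOp_add_shiftOp hq0 hq ht comm12_13 comm12_23.inv_right
      comm13_23.inv_right h12x (aut_apply_inv_of_fixed h12y) h12z h13x
      (aut_apply_inv_of_fixed h13y) h13z h23x' h23y' h23z' hx0 hy0' hz0 hx hqx hxq hy' hz
    have p3 := qCommutator_shiftOp_add_shiftOp hq0 hq ht comm12_13.inv_right comm12_23
      comm13_23.inv_left h12x h12y (aut_apply_inv_of_fixed h12z) h13x' h13y' h13z'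
      h23x h23y (aut_apply_inv_of_fixed h23z) hx0 hy0 hz0' hx hqx hxq hy hz'
    have p4 := qCommutator_shiftOp_add_shiftOp hq0 hq ht comm12_13.inv_right comm12_23.inv_right
      comm13_23.inv_left.inv_right h12x (aut_apply_inv_of_fixed h12y)
      (aut_apply_inv_of_fixed h12z) h13x' (aut_apply_inv_of_fixed h13y') h13z'
      h23x' h23y' (aut_apply_inv_of_fixed h23z') hx0 hy0' hz0' hx hqx hxq hy' hz'
    have hst : algebraMap kk KK (t4 ^ 2) = st := rfl
    simp only [shiftCoeff_inv_middle, hst] at p1 p2 p3 p4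
    rw [h12, hO3, qCommutator_add_left, qCommutator_add_right, p1, p2, qCommutator_add_right, p3,
      p4]
end
end

section
/- For every quadruple (X₁,Y₁,X₂,Y₂) of matrices in SL(2,ℂ) satisfying X₁Y₁X₁⁻¹Y₁⁻¹X₂Y₂X₂⁻¹Y₂⁻¹ = 1, the following trace identity holds: tr(Y₁Y₂)·tr(Y₂) + tr(X₂)·tr(X₂Y₁⁻¹) − tr(Y₂⁻¹Y₁⁻¹X₂)·tr(Y₂X₂) − 2·tr(Y₁) = 0. -/
noncomputable section

/-- `SL(2,ℂ)`. -/
abbrev SL2 : Type := Matrix.SpecialLinearGroup (Fin 2) ℂ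

/-- The trace of an element of `SL(2,ℂ)`. -/
def tr (M : SL2) : ℂ := Matrix.trace (M : Matrix (Fin 2) (Fin 2) ℂ)

/-- The genus-two surface relation `X₁Y₁X₁⁻¹Y₁⁻¹X₂Y₂X₂⁻¹Y₂⁻¹ = 1`. -/
def SurfRel (X1 Y1 X2 Y2 : SL2) : Prop :=
  X1 * Y1 * X1⁻¹ * Y1⁻¹ * X2 * Y2 * X2⁻¹ * Y2⁻¹ = 1

theorem tr_mul_comm (A B : SL2) : tr (A * B) = tr (B * A) := by
  simp only [tr, Matrix.SpecialLinearGroup.coe_mul]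
  exact Matrix.trace_mul_comm _ _

theorem tr_inv (A : SL2) : tr A⁻¹ = tr A := by
  simp only [tr, Matrix.SpecialLinearGroup.coe_inv, Matrix.trace_fin_two,
    Matrix.adjugate_fin_two]
  simp [add_comm]

theorem tr_mul_tr (A B : SL2) : tr A * tr B = tr (A * B) + tr (A * B⁻¹) := by
  simp only [tr, Matrix.SpecialLinearGroup.coe_mul, Matrix.SpecialLinearGroup.coe_inv,
    Matrix.trace_fin_two, Matrix.adjugate_fin_two, Matrix.mul_apply, Fin.sum_univ_two,
    Matrix.of_apply, Matrix.cons_val', Matrix.cons_val_zero, Matrix.cons_val_one,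
    Matrix.cons_val_fin_one]
  ring

theorem tr_conj (A B : SL2) : tr (A * B * A⁻¹) = tr B := by
  rw [tr_mul_comm, inv_mul_cancel_left]

theorem SurfRel.tr_inv_mul_commutator {X1 Y1 X2 Y2 : SL2} (h : SurfRel X1 Y1 X2 Y2) :
    tr (Y1⁻¹ * X2 * Y2 * X2⁻¹ * Y2⁻¹) = tr Y1 := by
  have hconj : Y1⁻¹ * X2 * Y2 * X2⁻¹ * Y2⁻¹ = (X1 * Y1 * X1⁻¹)⁻¹ := by
    refine eq_inv_of_mul_eq_one_right ?_
    simpa only [SurfRel, mul_assoc] using h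
  rw [hconj, tr_inv, tr_conj]

/-- the trace identity
`tr(Y₁Y₂)tr(Y₂) + tr(X₂)tr(X₂Y₁⁻¹) − tr(Y₂⁻¹Y₁⁻¹X₂)tr(Y₂X₂) − 2tr(Y₁) = 0` on the
genus-two representation variety. -/
theorem trace_identity_16 (X1 Y1 X2 Y2 : SL2) (h : SurfRel X1 Y1 X2 Y2) :
    tr (Y1 * Y2) * tr Y2 + tr X2 * tr (X2 * Y1⁻¹)
      - tr (Y2⁻¹ * Y1⁻¹ * X2) * tr (Y2 * X2) - 2 * tr Y1 = 0 := by
  have hrel := h.tr_inv_mul_commutator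
  have hY : tr (Y1 * Y2) * tr Y2 = tr (Y1 * Y2 * Y2) + tr Y1 := by
    rw [tr_mul_tr, mul_inv_cancel_right]
  have hprod : tr (Y2⁻¹ * Y1⁻¹ * X2) * tr (Y2 * X2)
      = tr (Y1⁻¹ * X2 * Y2 * X2 * Y2⁻¹) + tr (Y1 * Y2 * Y2) := by
    rw [tr_mul_tr, ← tr_inv (Y2⁻¹ * Y1⁻¹ * X2 * (Y2 * X2)⁻¹),
      tr_mul_comm (Y1⁻¹ * X2 * Y2 * X2), tr_mul_comm (Y1 * Y2)]
    simp only [mul_inv_rev, inv_inv, mul_assoc, mul_inv_cancel_left]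
  have hX : tr X2 * tr (X2 * Y1⁻¹)
      = tr (Y1⁻¹ * X2 * Y2 * X2 * Y2⁻¹) + tr (Y1⁻¹ * X2 * Y2 * X2⁻¹ * Y2⁻¹) := by
    rw [← tr_conj Y2 X2, tr_mul_comm X2, mul_comm, tr_mul_tr]
    simp only [mul_inv_rev, inv_inv, mul_assoc]
  linear_combination hY + hX - hprod + hrel
end
end
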